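/- Let q₁ ≥ 1 and q₂ > 0, set q := max{q₁,q₂}, and assume q ≥ 1 and D ≥ 1. Define f(x) := D·log₂(8x·q₁³ + 7q₁³·q₂ + 2D·q₁) + (q₁+q₂)·D/2 + D for x ≥ 0. For n ∈ ℕ set ε_n := 1/log₂(n+8), K_n := log₂(n+8) + 9 + ⌈1 + log₂(log₂(n+8) + 9)⌉, and κ_n := K_n·q·D^{1+ε_n}. Then for every n ∈ ℕ: (i) f(x) ≤ κ_n for all x ∈ [0, κ_n]; (ii) f(x) < x for all x > κ_n; consequently (iii) every x ≥ 0 with x ≤ f(x) satisfies x ≤ κ_n. -/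

import Mathlib

lemma logb_two_le_aux (y : ℝ) (hy : 1 ≤ y) : Real.logb 2 y ≤ 3 / 2 * (y - 1) := by
  have h2 := Real.log_two_gt_d9
  have h := Real.log_le_sub_one_of_pos (by linarith : 0 < y)
  rw [Real.logb, div_le_iff₀ (by linarith)]
  nlinarith

lemma two_rpow_aux (t : ℝ) (ht : 0 ≤ t) : t + 3 / 4 ≤ (2 : ℝ) ^ t := by
  have h2 := Real.log_two_gt_d9
  rw [Real.rpow_def_of_pos (by norm_num)]
  have hu : 0.69 * t ≤ Real.log 2 * t := by nlinarith
  have h := Real.quadratic_le_exp_of_nonneg (x := 0.69 * t) (by positivity)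
  have h3 := Real.exp_le_exp.mpr hu
  nlinarith [sq_nonneg (t - 0.65)]

set_option maxHeartbeats 1000000 in
/-- Lemma on the sequence `κ_n` of estimates: with `q = max{q₁,q₂}`,
`ε_n = 1/log₂(n+8)`, `K_n = log₂(n+8) + 9 + ⌈1 + log₂(log₂(n+8)+9)⌉` and
`κ_n = K_n·q·D^(1+ε_n)`, one has (i) `f x ≤ κ_n` on `[0, κ_n]`, (ii) `f x < x` for
`x > κ_n`, and hence (iii) any `x ≥ 0` with `x ≤ f x` satisfies `x ≤ κ_n`. -/
theorem kappa_sequence_bounds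
    (q₁ q₂ D : ℝ) (hq₁ : 1 ≤ q₁) (hq₂ : 0 < q₂)
    (q : ℝ) (hq_def : q = max q₁ q₂) (hq : 1 ≤ q) (hD : 1 ≤ D)
    (f : ℝ → ℝ)
    (hf : ∀ x : ℝ, f x = D * Real.logb 2 (8 * x * q₁ ^ 3 + 7 * q₁ ^ 3 * q₂ + 2 * D * q₁)
      + (q₁ + q₂) * D / 2 + D)
    (n : ℕ)
    (ε K κ : ℝ)
    (hε : ε = 1 / Real.logb 2 ((n : ℝ) + 8))
    (hK : K = Real.logb 2 ((n : ℝ) + 8) + 9 +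
      ((⌈1 + Real.logb 2 (Real.logb 2 ((n : ℝ) + 8) + 9)⌉ : ℤ) : ℝ))
    (hκ : κ = K * q * D ^ (1 + ε)) :
    (∀ x ∈ Set.Icc (0 : ℝ) κ, f x ≤ κ) ∧
    (∀ x : ℝ, κ < x → f x < x) ∧
    (∀ x : ℝ, 0 ≤ x → x ≤ f x → x ≤ κ) := by
  have hL : 3 ≤ Real.logb 2 ((n : ℝ) + 8) := by
    rw [Real.le_logb_iff_rpow_le (by norm_num) (by positivity)]
    have : (0 : ℝ) ≤ n := Nat.cast_nonneg n
    norm_num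
  set L := Real.logb 2 ((n : ℝ) + 8) with hLdef
  have hc : (2 : ℝ) ≤ ((⌈1 + Real.logb 2 (L + 9)⌉ : ℤ) : ℝ) := by
    have h1 : 1 ≤ Real.logb 2 (L + 9) := by
      rw [Real.le_logb_iff_rpow_le (by norm_num) (by positivity)]
      norm_num
      linarith
    have := Int.le_ceil (1 + Real.logb 2 (L + 9))
    linarith
  have hK14 : 14 ≤ K := by linarith
  have hKL : L + 1 ≤ K := by linarith
  have hq1 : q₁ ≤ q := hq_def ▸ le_max_left _ _
  have hq2 : q₂ ≤ q := hq_def ▸ le_max_right _ _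
  have hD0 : 0 < D := by linarith
  obtain ⟨t, ht⟩ : ∃ t, t = Real.logb 2 D * ε := ⟨_, rfl⟩
  have hlD : 0 ≤ Real.logb 2 D := Real.logb_nonneg (by norm_num) hD
  have hε0 : 0 ≤ ε := by rw [hε]; positivity
  have ht0 : 0 ≤ t := by rw [ht]; positivity
  have htL : Real.logb 2 D = L * t := by
    rw [ht, hε]; field_simp
  obtain ⟨E, hE⟩ : ∃ E, E = D ^ ε := ⟨_, rfl⟩
  have hE2 : E = (2 : ℝ) ^ t := by
    rw [ht, Real.rpow_mul (by norm_num), Real.rpow_logb (by norm_num) (by norm_num) hD0, hE]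
  have hE1 : 1 ≤ E := by rw [hE]; exact Real.one_le_rpow hD hε0
  have hlE : Real.logb 2 E = t := by
    rw [hE2]; exact Real.logb_rpow (by norm_num) (by norm_num)
  have hκ' : κ = K * q * (D * E) := by
    rw [hκ, Real.rpow_add hD0, Real.rpow_one, hE]
  have hDE : D ≤ D * E := by nlinarith
  have hKq : 14 ≤ K * q := by nlinarith
  have hκD : 14 * D ≤ κ := by
    rw [hκ']
    exact mul_le_mul hKq hDE hD0.le (by linarith)
  have hκ0 : 0 < κ := by linarith
  have hA0 : ∀ x : ℝ, 0 ≤ x → 0 < 8 * x * q₁ ^ 3 + 7 * q₁ ^ 3 * q₂ + 2 * D * q₁ := by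
    intro x hx
    positivity
  have hcube : q₁ ^ 3 ≤ q ^ 3 := by gcongr
  have hA : 8 * κ * q₁ ^ 3 + 7 * q₁ ^ 3 * q₂ + 2 * D * q₁
      ≤ q ^ 4 * (D * E) * (8 * K + 9) := by
    have hDE1 : 1 ≤ D * E := by linarith
    have h1 : 8 * κ * q₁ ^ 3 ≤ 8 * κ * q ^ 3 := by gcongr
    have h2 : 7 * q₁ ^ 3 * q₂ ≤ 7 * q ^ 3 * q := by gcongr
    have h2' : 7 * q ^ 3 * q ≤ 7 * q ^ 4 * (D * E) := by
      have : 0 ≤ q ^ 4 := by positivity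
      nlinarith
    have h3 : D * q₁ ≤ (D * E) * q ^ 4 := by
      have : q ≤ q ^ 4 := le_self_pow₀ hq (by norm_num)
      exact mul_le_mul hDE (by linarith) (by linarith) (by linarith)
    have h4 : 8 * κ * q ^ 3 = q ^ 4 * (D * E) * (8 * K) := by rw [hκ']; ring
    nlinarith
  have hlogA : Real.logb 2 (8 * κ * q₁ ^ 3 + 7 * q₁ ^ 3 * q₂ + 2 * D * q₁)
      ≤ 4 * Real.logb 2 q + (L * t + t) + Real.logb 2 (8 * K + 9) := by
    refine (Real.logb_le_logb_of_le (by norm_num) (hA0 κ hκ0.le) hA).trans ?_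
    have hq0 : q ≠ 0 := by linarith
    have hE0 : E ≠ 0 := by linarith
    have hK0 : 8 * K + 9 ≠ 0 := by linarith
    rw [Real.logb_mul (by positivity) hK0, Real.logb_mul (by positivity) (by positivity),
      Real.logb_mul hD0.ne' hE0, Real.logb_pow, hlE, htL]
    norm_num
  have hlq := logb_two_le_aux q hq
  have hlK : Real.logb 2 (8 * K + 9) ≤ 13 / 2 + 3 / 2 * ((8 * K + 9) / 64 - 1) := by
    have h := logb_two_le_aux ((8 * K + 9) / 64) (by linarith)
    rw [Real.logb_div (by linarith) (by norm_num)] at h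
    have h64 : Real.logb 2 64 = 6 := by
      rw [show (64 : ℝ) = 2 ^ (6 : ℝ) by norm_num]
      exact Real.logb_rpow (by norm_num) (by norm_num)
    linarith
  have hmain : f κ ≤ κ := by
    have h2t := two_rpow_aux t ht0
    rw [← hE2] at h2t
    have hKqt : K * q * (t + 3 / 4) ≤ K * q * E := by gcongr
    have hKK : K ≤ K * q := by nlinarith
    have h5 : (L + 1) * t ≤ K * q * t := by
      have : L + 1 ≤ K * q := by linarith
      gcongr
    have h6 : 14 * (q - 1) ≤ K * (q - 1) := by nlinarith
    have key : Real.logb 2 (8 * κ * q₁ ^ 3 + 7 * q₁ ^ 3 * q₂ + 2 * D * q₁)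
        + (q₁ + q₂) / 2 + 1 ≤ K * q * E := by
      linarith
    have h7 := mul_le_mul_of_nonneg_left key hD0.le
    rw [hf, hκ']
    rw [hκ'] at h7
    linarith
  have hii : ∀ x : ℝ, κ < x → f x < x := by
    intro x hx
    have hx0 : 0 < x := by linarith
    have hr : 1 ≤ x / κ := by rw [le_div_iff₀ hκ0]; linarith
    have hle : 8 * x * q₁ ^ 3 + 7 * q₁ ^ 3 * q₂ + 2 * D * q₁ ≤
        (x / κ) * (8 * κ * q₁ ^ 3 + 7 * q₁ ^ 3 * q₂ + 2 * D * q₁) := by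
      have e : (x / κ) * (8 * κ * q₁ ^ 3) = 8 * x * q₁ ^ 3 := by field_simp
      have p : 0 ≤ 7 * q₁ ^ 3 * q₂ + 2 * D * q₁ := by positivity
      nlinarith
    have h1 := Real.logb_le_logb_of_le (b := 2) (by norm_num) (hA0 x hx0.le) hle
    rw [Real.logb_mul (by positivity) (hA0 κ hκ0.le).ne'] at h1
    have h2 := logb_two_le_aux _ hr
    have h3 : D * (3 / 2 * (x / κ - 1)) < x - κ := by
      have : x - κ = κ * (x / κ - 1) := by field_simp
      rw [this]
      have : 0 < x / κ - 1 := by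
        have : 1 < x / κ := by rw [lt_div_iff₀ hκ0]; linarith
        linarith
      nlinarith
    have h4 := mul_le_mul_of_nonneg_left (h1.trans (add_le_add_left h2 _)) hD0.le
    rw [hf] at hmain ⊢
    linarith
  refine ⟨?_, hii, ?_⟩
  · rintro x ⟨hx0, hx⟩
    refine le_trans ?_ hmain
    rw [hf, hf]
    have : Real.logb 2 (8 * x * q₁ ^ 3 + 7 * q₁ ^ 3 * q₂ + 2 * D * q₁) ≤
        Real.logb 2 (8 * κ * q₁ ^ 3 + 7 * q₁ ^ 3 * q₂ + 2 * D * q₁) := by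
      apply Real.logb_le_logb_of_le (by norm_num) (hA0 x hx0)
      gcongr
    gcongr
  · intro x _ hxf
    by_contra! h
    linarith [hii x h]
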